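/- arXiv:2511.10181 — 6 statements merged into one kernel-verified Lean document; each statement's English description precedes it below -/
import Mathlib

section
/- For every distribution p ∈ 𝒫, if X is distributed according to p then E[log(p₀*(X)/q₀*(X))] = Σ_x p(x)·log(p₀*(x)/q₀*(x)) ≥ D(p₀*‖q₀*), with equality when p = p₀*. -/
open scoped BigOperators ENNReal

variable {𝒳 : Type*}

/-- A probability mass function on the finite alphabet `𝒳`. -/
def IsDist [Fintype 𝒳] (f : 𝒳 → ℝ) : Prop :=
  (∀ x, 0 ≤ f x) ∧ ∑ x, f x = 1

/-- Kullback–Leibler divergence `D(p‖q) = ∑ₓ p(x) log (p(x)/q(x))`. -/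
noncomputable def KL [Fintype 𝒳] (p q : 𝒳 → ℝ) : ℝ :=
  ∑ x, p x * Real.log (p x / q x)

/-- The chi-squared upper bound for one summand of the Kullback–Leibler divergence. -/
lemma mul_log_div_le_sq_div_add_sub {a b : ℝ} (ha : 0 < a) (hb : 0 < b) :
    a * Real.log (a / b) ≤ (a - b) ^ 2 / b + (a - b) := by
  calc a * Real.log (a / b) ≤ a * (a / b - 1) :=
        mul_le_mul_of_nonneg_left (Real.log_le_sub_one_of_pos (div_pos ha hb)) ha.le
    _ = (a - b) ^ 2 / b + (a - b) := by field_simp; ring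

/-- Upper bound on the divergence along the segment from `r` to `p`: a linear term plus a
quadratic remainder. -/
lemma KL_lineMap_le [Fintype 𝒳] {p r q : 𝒳 → ℝ} {t : ℝ}
    (hr : ∀ x, 0 < r x) (hq : ∀ x, 0 < q x) (hs : ∀ x, 0 < r x + t * (p x - r x))
    (hsum : ∑ x, p x = ∑ x, r x) :
    KL (fun x => r x + t * (p x - r x)) q ≤
      KL r q + t * (∑ x, p x * Real.log (r x / q x) - KL r q) +
        t ^ 2 * ∑ x, (p x - r x) ^ 2 / r x := by
  have hzero : ∑ x, t * (p x - r x) = 0 := by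
    rw [← Finset.mul_sum, Finset.sum_sub_distrib, hsum, sub_self, mul_zero]
  have hbound : KL (fun x => r x + t * (p x - r x)) q ≤
      ∑ x, (r x * Real.log (r x / q x) +
        t * (p x * Real.log (r x / q x) - r x * Real.log (r x / q x)) +
        t ^ 2 * ((p x - r x) ^ 2 / r x) + t * (p x - r x)) := by
    refine Finset.sum_le_sum fun x _ => ?_
    have h := mul_log_div_le_sq_div_add_sub (hs x) (hr x)
    rw [Real.log_div (hs x).ne' (hr x).ne'] at h
    simp only [Real.log_div (hs x).ne' (hq x).ne', Real.log_div (hr x).ne' (hq x).ne']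
    have e : (r x + t * (p x - r x) - r x) ^ 2 / r x = t ^ 2 * ((p x - r x) ^ 2 / r x) := by
      ring
    rw [e] at h
    linarith
  simpa only [KL, Finset.sum_add_distrib, ← Finset.mul_sum, Finset.sum_sub_distrib, hsum,
    sub_self, mul_zero, add_zero] using hbound

/-- A first-order condition: if `a` plus every small positive multiple of `c` is nonnegative,
then `a` is nonnegative. -/
lemma nonneg_of_forall_add_mul_nonneg {a c : ℝ}
    (h : ∀ t : ℝ, 0 < t → t ≤ 1 → 0 ≤ a + t * c) : 0 ≤ a := by
  have hlim : Filter.Tendsto (fun t : ℝ => a + t * c) (nhdsWithin 0 (Set.Ioi 0)) (nhds a) := by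
    have hc : Continuous fun t : ℝ => a + t * c := by fun_prop
    simpa using (hc.tendsto 0).mono_left nhdsWithin_le_nhds
  refine ge_of_tendsto hlim ?_
  filter_upwards [Ioc_mem_nhdsGT (zero_lt_one' ℝ)] with t ht using h t ht.1 ht.2

/-- For every `p ∈ 𝒫`, if `X ∼ p` then
`E[log (p₀*(X)/q₀*(X))] = ∑ₓ p(x) log (p₀*(x)/q₀*(x)) ≥ D(p₀*‖q₀*)`,
with equality when `p = p₀*`.  Here `(p₀*, q₀*)` is the closest pair between `𝒫`
and `𝒬` in forward KL divergence. -/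
theorem stmt0 [Fintype 𝒳] [Nonempty 𝒳]
    (P Q : Set (𝒳 → ℝ))
    (hP : ∀ p ∈ P, IsDist p) (hQ : ∀ q ∈ Q, IsDist q)
    (hPclosed : IsClosed P) (hQclosed : IsClosed Q)
    (hPconv : Convex ℝ P) (hQconv : Convex ℝ Q)
    (hdisj : Disjoint P Q)
    (hPfull : ∀ p ∈ P, ∀ x, 0 < p x) (hQfull : ∀ q ∈ Q, ∀ x, 0 < q x)
    (p₀ q₀ : 𝒳 → ℝ) (hp₀ : p₀ ∈ P) (hq₀ : q₀ ∈ Q)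
    (hmin₀ : ∀ p ∈ P, ∀ q ∈ Q, KL p₀ q₀ ≤ KL p q) :
    ∀ p ∈ P,
      KL p₀ q₀ ≤ ∑ x, p x * Real.log (p₀ x / q₀ x) ∧
      (p = p₀ → ∑ x, p x * Real.log (p₀ x / q₀ x) = KL p₀ q₀) := by
  intro p hp
  refine ⟨?_, fun h => by rw [h, KL]⟩
  refine sub_nonneg.mp (nonneg_of_forall_add_mul_nonneg
    (c := ∑ x, (p x - p₀ x) ^ 2 / p₀ x) fun t ht ht1 => ?_)
  have hmem : (fun x => p₀ x + t * (p x - p₀ x)) ∈ P :=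
    hPconv.add_smul_sub_mem hp₀ hp ⟨ht.le, ht1⟩
  have hle := (hmin₀ _ hmem q₀ hq₀).trans
    (KL_lineMap_le (hPfull p₀ hp₀) (hQfull q₀ hq₀) (hPfull _ hmem)
      ((hP p hp).2.trans (hP p₀ hp₀).2.symm))
  refine nonneg_of_mul_nonneg_right ?_ ht
  linarith
end

section
/- For every distribution q ∈ 𝒬, if X is distributed according to q then E[log(q₁*(X)/p₁*(X))] = Σ_x q(x)·log(q₁*(x)/p₁*(x)) ≥ D(q₁*‖p₁*), with equality when q = q₁*. -/
open scoped BigOperators ENNReal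

variable {𝒳 : Type*}

/-- The derivative of `KL` in its first argument along a direction of zero total mass. -/
theorem hasDerivAt_KL_line [Fintype 𝒳] {p r v : 𝒳 → ℝ} (hp : ∀ x, 0 < p x) (hr : ∀ x, 0 < r x)
    (hv : ∑ x, v x = 0) :
    HasDerivAt (fun t : ℝ => KL (r + t • v) p) (∑ x, v x * Real.log (r x / p x)) 0 := by
  have hsum : ∑ x, v x * Real.log (r x / p x) = ∑ x, (v x * Real.log (r x / p x) + v x) := by
    rw [Finset.sum_add_distrib, hv, add_zero]
  rw [hsum]
  refine HasDerivAt.fun_sum fun x _ => ?_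
  have hline : HasDerivAt (fun t : ℝ => (r + t • v) x) (v x) 0 := by
    simpa using ((hasDerivAt_id (0 : ℝ)).mul_const (v x)).const_add (r x)
  have hlog := (hline.div_const (p x)).log (by simpa using ⟨(hr x).ne', (hp x).ne'⟩)
  refine (hline.fun_mul hlog).congr_deriv ?_
  have := (hr x).ne'
  have := (hp x).ne'
  rw [zero_smul, add_zero]
  field_simp

/-- A function that is minimal at `0` over `[0, 1]` has nonnegative derivative at `0`. -/
theorem HasDerivAt.nonneg_of_forall_Icc_le {f : ℝ → ℝ} {f' : ℝ} (hf : HasDerivAt f f' 0)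
    (hmin : ∀ t ∈ Set.Icc (0 : ℝ) 1, f 0 ≤ f t) : 0 ≤ f' := by
  refine ge_of_tendsto hf.tendsto_slope_zero_right ?_
  filter_upwards [Ioc_mem_nhdsGT (zero_lt_one (α := ℝ))] with t ht
  rw [zero_add, smul_eq_mul]
  exact mul_nonneg (inv_nonneg.2 ht.1.le) (sub_nonneg.2 (hmin t ⟨ht.1.le, ht.2⟩))

/-- For every `q ∈ 𝒬`, if `X ∼ q` then
`E[log (q₁*(X)/p₁*(X))] = ∑ₓ q(x) log (q₁*(x)/p₁*(x)) ≥ D(q₁*‖p₁*)`,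
with equality when `q = q₁*`.  Here `(p₁*, q₁*)` is the closest pair between `𝒫`
and `𝒬` in reverse KL divergence. -/
theorem stmt1 [Fintype 𝒳] [Nonempty 𝒳]
    (P Q : Set (𝒳 → ℝ))
    (hP : ∀ p ∈ P, IsDist p) (hQ : ∀ q ∈ Q, IsDist q)
    (hPclosed : IsClosed P) (hQclosed : IsClosed Q)
    (hPconv : Convex ℝ P) (hQconv : Convex ℝ Q)
    (hdisj : Disjoint P Q)
    (hPfull : ∀ p ∈ P, ∀ x, 0 < p x) (hQfull : ∀ q ∈ Q, ∀ x, 0 < q x)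
    (p₁ q₁ : 𝒳 → ℝ) (hp₁ : p₁ ∈ P) (hq₁ : q₁ ∈ Q)
    (hmin₁ : ∀ p ∈ P, ∀ q ∈ Q, KL q₁ p₁ ≤ KL q p) :
    ∀ q ∈ Q,
      KL q₁ p₁ ≤ ∑ x, q x * Real.log (q₁ x / p₁ x) ∧
      (q = q₁ → ∑ x, q x * Real.log (q₁ x / p₁ x) = KL q₁ p₁) := by
  intro q hq
  refine ⟨?_, fun h => h ▸ rfl⟩
  have hv : ∑ x, (q - q₁) x = 0 := by
    simp [Finset.sum_sub_distrib, (hQ q hq).2, (hQ q₁ hq₁).2]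
  have hderiv := (hasDerivAt_KL_line (hPfull p₁ hp₁) (hQfull q₁ hq₁) hv).nonneg_of_forall_Icc_le
    fun t ht => by
      simpa using hmin₁ p₁ hp₁ _ (hQconv.add_smul_sub_mem hq₁ hq ht)
  simp only [Pi.sub_apply, sub_mul, Finset.sum_sub_distrib] at hderiv
  exact sub_nonneg.1 hderiv
end

section
/- For every distribution q ∈ 𝒬, if X is distributed according to q then E[p₀*(X)/q₀*(X)] = Σ_x q(x)·p₀*(x)/q₀*(x) ≤ 1. -/
open scoped BigOperators ENNReal

variable {𝒳 : Type*}

/-- If `q` does not decrease the divergence from `p`, then moving from `r` to `q` has nonpositive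
first-order gain up to the weights `1 / q`. -/
theorem sum_mul_sub_div_nonpos_of_KL_le [Fintype 𝒳] {p q r : 𝒳 → ℝ}
    (hp : ∀ x, 0 < p x) (hq : ∀ x, 0 < q x) (hr : ∀ x, 0 < r x) (h : KL p r ≤ KL p q) :
    ∑ x, p x * ((q x - r x) / q x) ≤ 0 := by
  have hle : ∑ x, p x * ((q x - r x) / q x) ≤ KL p r - KL p q := by
    unfold KL
    rw [← Finset.sum_sub_distrib]
    refine Finset.sum_le_sum fun x _ => ?_
    rw [← mul_sub]
    refine mul_le_mul_of_nonneg_left ?_ (hp x).le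
    have hlog := Real.log_le_sub_one_of_pos (div_pos (hr x) (hq x))
    rw [Real.log_div (hr x).ne' (hq x).ne'] at hlog
    rw [Real.log_div (hp x).ne' (hr x).ne', Real.log_div (hp x).ne' (hq x).ne',
      sub_div, div_self (hq x).ne']
    linarith
  linarith

/-- For every `q ∈ 𝒬`, if `X ∼ q` then
`E[p₀*(X)/q₀*(X)] = ∑ₓ q(x) · p₀*(x)/q₀*(x) ≤ 1`, where `(p₀*, q₀*)` is the closest
pair between `𝒫` and `𝒬` in forward KL divergence. -/
theorem stmt2 [Fintype 𝒳] [Nonempty 𝒳]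
    (P Q : Set (𝒳 → ℝ))
    (hP : ∀ p ∈ P, IsDist p) (hQ : ∀ q ∈ Q, IsDist q)
    (hPclosed : IsClosed P) (hQclosed : IsClosed Q)
    (hPconv : Convex ℝ P) (hQconv : Convex ℝ Q)
    (hdisj : Disjoint P Q)
    (hPfull : ∀ p ∈ P, ∀ x, 0 < p x) (hQfull : ∀ q ∈ Q, ∀ x, 0 < q x)
    (p₀ q₀ : 𝒳 → ℝ) (hp₀ : p₀ ∈ P) (hq₀ : q₀ ∈ Q)
    (hmin₀ : ∀ p ∈ P, ∀ q ∈ Q, KL p₀ q₀ ≤ KL p q) :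
    ∀ q ∈ Q, ∑ x, q x * (p₀ x / q₀ x) ≤ 1 := by
  intro q hq
  have hsum : ∑ x, p₀ x * ((q x - q₀ x) / q₀ x) = ∑ x, q x * (p₀ x / q₀ x) - 1 := by
    rw [← (hP p₀ hp₀).2, ← Finset.sum_sub_distrib]
    refine Finset.sum_congr rfl fun x _ => ?_
    have := (hQfull q₀ hq₀ x).ne'
    field_simp
  have hcont : ContinuousAt
      (fun t : ℝ => ∑ x, p₀ x * ((q x - q₀ x) / (q₀ x + t * (q x - q₀ x)))) 0 := by
    refine tendsto_finsetSum _ fun x _ => ?_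
    refine ContinuousAt.mul continuousAt_const (ContinuousAt.div continuousAt_const ?_ ?_)
    · fun_prop
    · simpa using (hQfull q₀ hq₀ x).ne'
  have hlim : Filter.Tendsto
      (fun t : ℝ => ∑ x, p₀ x * ((q x - q₀ x) / (q₀ x + t * (q x - q₀ x))))
      (nhdsWithin 0 (Set.Ioi 0)) (nhds (∑ x, p₀ x * ((q x - q₀ x) / q₀ x))) := by
    simpa [ContinuousAt] using hcont.tendsto.mono_left nhdsWithin_le_nhds
  have hle : ∑ x, p₀ x * ((q x - q₀ x) / q₀ x) ≤ 0 := by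
    refine le_of_tendsto hlim ?_
    filter_upwards [Ioo_mem_nhdsGT (zero_lt_one' ℝ)] with t ht
    have hmem : q₀ + t • (q - q₀) ∈ Q := hQconv.add_smul_sub_mem hq₀ hq ⟨ht.1.le, ht.2.le⟩
    have hgain := sum_mul_sub_div_nonpos_of_KL_le (hPfull p₀ hp₀) (hQfull _ hmem)
      (hQfull q₀ hq₀) (hmin₀ p₀ hp₀ _ hmem)
    have hscale : ∑ x, p₀ x * (((q₀ + t • (q - q₀)) x - q₀ x) / (q₀ + t • (q - q₀)) x)
        = t * ∑ x, p₀ x * ((q x - q₀ x) / (q₀ x + t * (q x - q₀ x))) := by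
      rw [Finset.mul_sum]
      refine Finset.sum_congr rfl fun x _ => ?_
      simp only [Pi.add_apply, Pi.smul_apply, Pi.sub_apply, smul_eq_mul]
      ring
    rw [hscale] at hgain
    exact nonpos_of_mul_nonpos_right hgain ht.1
  linarith
end

section
/- For every distribution p ∈ 𝒫, if X is distributed according to p then E[q₁*(X)/p₁*(X)] = Σ_x p(x)·q₁*(x)/p₁*(x) ≤ 1. -/
open scoped BigOperators ENNReal

variable {𝒳 : Type*}

/-- A function that is minimal at `0` on `(0, 1)` has nonnegative derivative there. -/
theorem HasDerivAt.nonneg_of_forall_le {f : ℝ → ℝ} {f' : ℝ} (hf : HasDerivAt f f' 0)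
    (hmin : ∀ t, 0 < t → t < 1 → f 0 ≤ f t) : 0 ≤ f' := by
  refine ge_of_tendsto hf.tendsto_slope_zero_right ?_
  filter_upwards [Ioo_mem_nhdsGT (zero_lt_one' ℝ)] with t ht
  rw [zero_add, smul_eq_mul]
  exact mul_nonneg (inv_nonneg.2 ht.1.le) (sub_nonneg.2 (hmin t ht.1 ht.2))

/-- The derivative of `D(q‖·)` at `p` in the direction `d`. -/
theorem hasDerivAt_KL_add_smul [Fintype 𝒳] {p q : 𝒳 → ℝ} (hp : ∀ x, 0 < p x)
    (hq : ∀ x, 0 < q x) (d : 𝒳 → ℝ) :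
    HasDerivAt (fun t : ℝ => KL q (p + t • d)) (-∑ x, d x * (q x / p x)) 0 := by
  unfold KL
  rw [← Finset.sum_neg_distrib]
  refine HasDerivAt.fun_sum fun x _ => ?_
  have hp' := (hp x).ne'
  have hq' := (hq x).ne'
  have hlin : HasDerivAt (fun t : ℝ => (p + t • d) x) (d x) 0 := by
    simpa using ((hasDerivAt_id (0 : ℝ)).mul_const (d x)).const_add (p x)
  have hne : (p + (0 : ℝ) • d) x ≠ 0 := by simpa using hp'
  have hdiv := (hasDerivAt_const (0 : ℝ) (q x)).fun_div hlin hne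
  refine ((hdiv.log (div_ne_zero hq' hne)).const_mul (q x)).congr_deriv ?_
  simp only [zero_smul, add_zero]
  field_simp
  ring

/-- For every `p ∈ 𝒫`, if `X ∼ p` then
`E[q₁*(X)/p₁*(X)] = ∑ₓ p(x) · q₁*(x)/p₁*(x) ≤ 1`, where `(p₁*, q₁*)` is the closest
pair between `𝒫` and `𝒬` in reverse KL divergence. -/
theorem stmt3 [Fintype 𝒳] [Nonempty 𝒳]
    (P Q : Set (𝒳 → ℝ))
    (hP : ∀ p ∈ P, IsDist p) (hQ : ∀ q ∈ Q, IsDist q)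
    (hPclosed : IsClosed P) (hQclosed : IsClosed Q)
    (hPconv : Convex ℝ P) (hQconv : Convex ℝ Q)
    (hdisj : Disjoint P Q)
    (hPfull : ∀ p ∈ P, ∀ x, 0 < p x) (hQfull : ∀ q ∈ Q, ∀ x, 0 < q x)
    (p₁ q₁ : 𝒳 → ℝ) (hp₁ : p₁ ∈ P) (hq₁ : q₁ ∈ Q)
    (hmin₁ : ∀ p ∈ P, ∀ q ∈ Q, KL q₁ p₁ ≤ KL q p) :
    ∀ p ∈ P, ∑ x, p x * (q₁ x / p₁ x) ≤ 1 := by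
  intro p hp
  have hderiv := (hasDerivAt_KL_add_smul (hPfull p₁ hp₁) (hQfull q₁ hq₁) (p - p₁)).nonneg_of_forall_le
    fun t ht0 ht1 => by
      simpa using hmin₁ _ (hPconv.add_smul_sub_mem hp₁ hp ⟨ht0.le, ht1.le⟩) q₁ hq₁
  have hsum : ∑ x, (p - p₁) x * (q₁ x / p₁ x) = ∑ x, p x * (q₁ x / p₁ x) - 1 := by
    rw [← (hQ q₁ hq₁).2, ← Finset.sum_sub_distrib]
    refine Finset.sum_congr rfl fun x _ => ?_
    rw [Pi.sub_apply, sub_mul, mul_div_cancel₀ _ (hPfull p₁ hp₁ x).ne']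
  linarith
end

section
/- Under any adaptive adversary strategy for H₀ (i.e., under the induced law ℙ), the process M_{0,t} := S_{0,t} − t·D(p₀*‖q₀*) (with M_{0,0} := 0) is a submartingale with respect to the natural filtration of the observations; moreover, if the observations are i.i.d. according to p₀* then (M_{0,t})_t is a martingale. Symmetrically, under any adaptive adversary strategy for H₁ (law ℚ), M_{1,t} := S_{1,t} − t·D(q₁*‖p₁*) is a submartingale, and a martingale when the observations are i.i.d. according to q₁*. -/
open scoped BigOperators ENNReal

variable {𝒳 : Type*}

/-- Probability of observing the finite sequence `l` under the adaptive strategy `str`: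
`ℙ(x^t) = ∏ᵢ str(x^{i-1})(xᵢ)`. -/
noncomputable def seqProb [Fintype 𝒳] (str : List 𝒳 → 𝒳 → ℝ) (l : List 𝒳) : ℝ :=
  ∏ i : Fin l.length, str (l.take i.1) (l.get i)

/-- Log-likelihood-ratio sum `S_t = ∑ᵢ log (p(xᵢ)/q(xᵢ))`. -/
noncomputable def llSum (p q : 𝒳 → ℝ) (l : List 𝒳) : ℝ :=
  ∑ i : Fin l.length, Real.log (p (l.get i) / q (l.get i))

/-- An adaptive adversary strategy choosing, after each history, a distribution in `P`. -/
def IsStrategy (P : Set (𝒳 → ℝ)) (str : List 𝒳 → 𝒳 → ℝ) : Prop :=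
  ∀ l, str l ∈ P

open Classical in
/-- Probability that the first `n` observations form a sequence satisfying `E`. -/
noncomputable def probAt [Fintype 𝒳] (str : List 𝒳 → 𝒳 → ℝ) (n : ℕ)
    (E : List 𝒳 → Prop) : ℝ :=
  ∑ x : Fin n → 𝒳, if E (List.ofFn x) then seqProb str (List.ofFn x) else 0

/-- No prefix of `l` (including `l` itself) lies in the stopping region `B`;
for `l` of length `n` this is the event `{τ_B > n}`. -/
def notYet (B : List 𝒳 → Prop) (l : List 𝒳) : Prop :=
  ∀ t ≤ l.length, ¬ B (l.take t)

/-- `l` is a stopped sequence of the first-hitting time `τ_B` of the region `B`. -/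
def stopsAt (B : List 𝒳 → Prop) (l : List 𝒳) : Prop :=
  B l ∧ ∀ t < l.length, ¬ B (l.take t)

/-- Expected stopping time `E[τ_B] = ∑_{n ≥ 0} ℙ(τ_B > n)`, valued in `ℝ≥0∞`. -/
noncomputable def expTau [Fintype 𝒳] (str : List 𝒳 → 𝒳 → ℝ) (B : List 𝒳 → Prop) : ℝ≥0∞ :=
  ∑' n : ℕ, ENNReal.ofReal (probAt str n (notYet B))

open Classical in
/-- Expectation of `f` evaluated at the stopped sequence `X^{τ_B}`. -/
noncomputable def expStopped [Fintype 𝒳] (str : List 𝒳 → 𝒳 → ℝ) (B : List 𝒳 → Prop)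
    (f : List 𝒳 → ℝ) : ℝ :=
  ∑' l : List 𝒳, if stopsAt B l then seqProb str l * f l else 0

open Classical in
/-- Probability that the process stops (via `B`) at a sequence satisfying `E`. -/
noncomputable def probStopIn [Fintype 𝒳] (str : List 𝒳 → 𝒳 → ℝ) (B : List 𝒳 → Prop)
    (E : List 𝒳 → Prop) : ℝ :=
  ∑' l : List 𝒳, if stopsAt B l ∧ E l then seqProb str l else 0

/-- Pointwise quadratic upper bound for `t ↦ t log (t / c)` around a positive point `a`. -/
theorem mul_log_div_le_of_pos {a b c s : ℝ} (ha : 0 < a) (hb : 0 < b) (hc : 0 < c)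
    (hs : 0 ≤ s) (hs1 : s ≤ 1) :
    ((1 - s) * a + s * b) * Real.log (((1 - s) * a + s * b) / c) ≤
      a * Real.log (a / c) + s * ((b - a) * Real.log (a / c)) + s * (b - a)
        + s ^ 2 * ((b - a) ^ 2 / a) := by
  have hm : 0 < (1 - s) * a + s * b := by
    have : min a b ≤ (1 - s) * a + s * b := by
      nlinarith [min_le_left a b, min_le_right a b]
    exact (lt_min ha hb).trans_le this
  have hlog : Real.log (((1 - s) * a + s * b) / c) =
      Real.log (((1 - s) * a + s * b) / a) + Real.log (a / c) := by
    rw [← Real.log_mul (by positivity) (by positivity)]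
    congr 1
    field_simp
  have hle := mul_le_mul_of_nonneg_left
    (Real.log_le_sub_one_of_pos (div_pos hm ha)) hm.le
  have hexp : ((1 - s) * a + s * b) * (((1 - s) * a + s * b) / a - 1) =
      s * (b - a) + s ^ 2 * ((b - a) ^ 2 / a) := by
    field_simp
    ring
  rw [hlog]
  linear_combination hle + hexp

/-- A linear form dominated below by a quadratic correction near `0⁺` is nonnegative. -/
theorem nonneg_of_forall_mul_add_sq_mul_nonneg {A C : ℝ} (hC : 0 ≤ C)
    (h : ∀ s : ℝ, 0 ≤ s → s ≤ 1 → 0 ≤ s * A + s ^ 2 * C) : 0 ≤ A := by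
  by_contra! hA
  have hCA : 0 < C - A := by linarith
  have hs : 0 < -A / (C - A) := div_pos (by linarith) hCA
  have hs1 : -A / (C - A) ≤ 1 := by
    rw [div_le_one hCA]
    linarith
  have h1 := h _ hs.le hs1
  have h2 : -A / (C - A) * A + (-A / (C - A)) ^ 2 * C = -(A ^ 2 * (-A)) / (C - A) ^ 2 := by
    field_simp
    ring
  have h3 : 0 < A ^ 2 * (-A) / (C - A) ^ 2 := by
    have : 0 < -A := by linarith
    have : 0 < A ^ 2 := by nlinarith
    positivity
  rw [h2, neg_div] at h1
  linarith

/-- Pythagorean-type inequality for the information projection `p₀` of `q` onto a convex set. -/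
theorem KL_le_sum_mul_log_of_isMin [Fintype 𝒳] {P : Set (𝒳 → ℝ)}
    (hP : ∀ p ∈ P, IsDist p) (hconv : Convex ℝ P) {p₀ q p : 𝒳 → ℝ} (hq : IsDist q)
    (hac : ∀ p ∈ P, ∀ x, (p x = 0 ↔ q x = 0))
    (hp₀ : p₀ ∈ P) (hp : p ∈ P) (hmin : ∀ p ∈ P, KL p₀ q ≤ KL p q) :
    KL p₀ q ≤ ∑ x, p x * Real.log (p₀ x / q x) := by
  have hpoint : ∀ s : ℝ, 0 ≤ s → s ≤ 1 → ∀ x,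
      ((1 - s) * p₀ x + s * p x) * Real.log (((1 - s) * p₀ x + s * p x) / q x) ≤
        p₀ x * Real.log (p₀ x / q x) + s * ((p x - p₀ x) * Real.log (p₀ x / q x))
          + s * (p x - p₀ x) + s ^ 2 * ((p x - p₀ x) ^ 2 / p₀ x) := by
    intro s hs hs1 x
    by_cases hx : q x = 0
    · simp [hx, (hac p hp x).2 hx, (hac p₀ hp₀ x).2 hx]
    · exact mul_log_div_le_of_pos
        (((hP p₀ hp₀).1 x).lt_of_ne' fun h => hx ((hac p₀ hp₀ x).1 h))
        (((hP p hp).1 x).lt_of_ne' fun h => hx ((hac p hp x).1 h))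
        ((hq.1 x).lt_of_ne' hx) hs hs1
  have hA : 0 ≤ ∑ x, (p x - p₀ x) * Real.log (p₀ x / q x) := by
    refine nonneg_of_forall_mul_add_sq_mul_nonneg
      (C := ∑ x, (p x - p₀ x) ^ 2 / p₀ x)
      (Finset.sum_nonneg fun x _ => div_nonneg (sq_nonneg _) ((hP p₀ hp₀).1 x)) ?_
    intro s hs hs1
    have hmem := hconv hp₀ hp (sub_nonneg.2 hs1) hs (by ring)
    have h1 := hmin _ hmem
    have h2 := Finset.sum_le_sum fun x (_ : x ∈ Finset.univ) => hpoint s hs hs1 x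
    simp only [Finset.sum_add_distrib, ← Finset.mul_sum, Finset.sum_sub_distrib,
      (hP p hp).2, (hP p₀ hp₀).2] at h2
    simp only [KL, Pi.add_apply, Pi.smul_apply, smul_eq_mul] at h1
    linarith
  simp only [sub_mul, Finset.sum_sub_distrib] at hA
  unfold KL
  linarith

/-- Appending an observation adds its log-likelihood ratio. -/
theorem llSum_append_singleton (p q : 𝒳 → ℝ) (l : List 𝒳) (x : 𝒳) :
    llSum p q (l ++ [x]) = llSum p q l + Real.log (p x / q x) := by
  have h : ∀ l : List 𝒳, llSum p q l = (l.map fun y => Real.log (p y / q y)).sum := by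
    intro l
    rw [← Fin.sum_univ_fun_getElem]
    rfl
  simp [h]

/-- One-step conditional expectation of the compensated log-likelihood-ratio sum. -/
theorem sum_mul_llSum_append_singleton [Fintype 𝒳] {r : 𝒳 → ℝ} (hr : IsDist r)
    (p q : 𝒳 → ℝ) (l : List 𝒳) (c : ℝ) :
    ∑ x, r x * (llSum p q (l ++ [x]) - ((l ++ [x]).length : ℝ) * c) =
      llSum p q l - (l.length : ℝ) * c + (∑ x, r x * Real.log (p x / q x) - c) := by
  have h : ∀ x, r x * (llSum p q (l ++ [x]) - ((l ++ [x]).length : ℝ) * c) =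
      r x * (llSum p q l - (l.length : ℝ) * c - c) + r x * Real.log (p x / q x) := by
    intro x
    rw [llSum_append_singleton, List.length_append, List.length_singleton]
    push_cast
    ring
  simp only [h, Finset.sum_add_distrib, ← Finset.sum_mul, hr.2]
  ring

/-- Under any adaptive adversary strategy for `H₀` (law `ℙ`), the process
`M_{0,t} = S_{0,t} − t·D(p₀*‖q₀*)` is a submartingale with respect to the natural filtration
(expressed through its one-step conditional-expectation characterization: conditioned on any
history `l`, the expected next value is at least the current value), and it is a martingale
when the observations are i.i.d. according to `p₀*`.  Symmetrically for
`M_{1,t} = S_{1,t} − t·D(q₁*‖p₁*)` under `H₁`. -/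
theorem stmt4 [Fintype 𝒳] [Nonempty 𝒳]
    (P Q : Set (𝒳 → ℝ))
    (hP : ∀ p ∈ P, IsDist p) (hQ : ∀ q ∈ Q, IsDist q)
    (hPclosed : IsClosed P) (hQclosed : IsClosed Q)
    (hPconv : Convex ℝ P) (hQconv : Convex ℝ Q)
    (hdisj : Disjoint P Q)
    (hac : ∀ p ∈ P, ∀ q ∈ Q, ∀ x, (p x = 0 ↔ q x = 0))
    (p₀ q₀ : 𝒳 → ℝ) (hp₀ : p₀ ∈ P) (hq₀ : q₀ ∈ Q)
    (hmin₀ : ∀ p ∈ P, ∀ q ∈ Q, KL p₀ q₀ ≤ KL p q)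
    (p₁ q₁ : 𝒳 → ℝ) (hp₁ : p₁ ∈ P) (hq₁ : q₁ ∈ Q)
    (hmin₁ : ∀ p ∈ P, ∀ q ∈ Q, KL q₁ p₁ ≤ KL q p)
    (strP strQ : List 𝒳 → 𝒳 → ℝ)
    (hstrP : IsStrategy P strP) (hstrQ : IsStrategy Q strQ) :
    (∀ l : List 𝒳,
      llSum p₀ q₀ l - (l.length : ℝ) * KL p₀ q₀ ≤
        ∑ x, strP l x * (llSum p₀ q₀ (l ++ [x]) - ((l ++ [x]).length : ℝ) * KL p₀ q₀)) ∧
    (∀ l : List 𝒳,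
      ∑ x, p₀ x * (llSum p₀ q₀ (l ++ [x]) - ((l ++ [x]).length : ℝ) * KL p₀ q₀) =
        llSum p₀ q₀ l - (l.length : ℝ) * KL p₀ q₀) ∧
    (∀ l : List 𝒳,
      llSum q₁ p₁ l - (l.length : ℝ) * KL q₁ p₁ ≤
        ∑ x, strQ l x * (llSum q₁ p₁ (l ++ [x]) - ((l ++ [x]).length : ℝ) * KL q₁ p₁)) ∧
    (∀ l : List 𝒳,
      ∑ x, q₁ x * (llSum q₁ p₁ (l ++ [x]) - ((l ++ [x]).length : ℝ) * KL q₁ p₁) =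
        llSum q₁ p₁ l - (l.length : ℝ) * KL q₁ p₁) := by
  refine ⟨fun l => ?_, fun l => ?_, fun l => ?_, fun l => ?_⟩
  · rw [sum_mul_llSum_append_singleton (hP _ (hstrP l))]
    have := KL_le_sum_mul_log_of_isMin hP hPconv (hQ q₀ hq₀) (fun p hp => hac p hp q₀ hq₀)
      hp₀ (hstrP l) fun p hp => hmin₀ p hp q₀ hq₀
    linarith
  · rw [sum_mul_llSum_append_singleton (hP _ hp₀)]
    simp [KL]
  · rw [sum_mul_llSum_append_singleton (hQ _ (hstrQ l))]
    have := KL_le_sum_mul_log_of_isMin hQ hQconv (hP p₁ hp₁)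
      (fun q hq x => (hac p₁ hp₁ q hq x).symm) hq₁ (hstrQ l) fun q hq => hmin₁ p₁ hp₁ q hq
    linarith
  · rw [sum_mul_llSum_append_singleton (hQ _ hq₁)]
    simp [KL]
end

section
/- Let θ₁ > 0 and τ₁ := inf{t ∈ ℕ : S_{1,t} ≥ θ₁}. Under any adaptive adversary strategy for H₀ (law ℙ), E_ℙ[2^{S_{1,τ₁}}] ≤ 1. -/
open scoped BigOperators ENNReal

variable {𝒳 : Type*}

/-- Kullback–Leibler divergence with base-2 logarithms. -/
noncomputable def KL2 [Fintype 𝒳] (p q : 𝒳 → ℝ) : ℝ :=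
  ∑ x, p x * Real.logb 2 (p x / q x)

/-- Log-likelihood-ratio sum `S_t` with base-2 logarithms. -/
noncomputable def llSum2 (p q : 𝒳 → ℝ) (l : List 𝒳) : ℝ :=
  ∑ i : Fin l.length, Real.logb 2 (p (l.get i) / q (l.get i))

/-- First-order optimality of `p₁` as a reverse information projection of `q₁` onto `P`. -/
theorem sum_mul_rpow_logb_le_one [Fintype 𝒳] {P : Set (𝒳 → ℝ)} {p₁ q₁ p : 𝒳 → ℝ}
    (hP : ∀ p ∈ P, IsDist p) (hPconv : Convex ℝ P) (hq : IsDist q₁)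
    (hac : ∀ p ∈ P, ∀ x, p x = 0 ↔ q₁ x = 0) (hp₁ : p₁ ∈ P) (hp : p ∈ P)
    (hmin : ∀ p ∈ P, KL2 q₁ p₁ ≤ KL2 q₁ p) :
    ∑ x, p x * (2 : ℝ) ^ Real.logb 2 (q₁ x / p₁ x) ≤ 1 := by
  have pos : ∀ r ∈ P, ∀ x, q₁ x ≠ 0 → 0 < r x := fun r hr x hx =>
    lt_of_le_of_ne ((hP r hr).1 x) fun h => hx ((hac r hr x).1 h.symm)
  have key : ∀ t ∈ Set.Ioo (0 : ℝ) 1,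
      ∑ x, q₁ x * ((p x / p₁ x - 1) / (1 + t * (p x / p₁ x - 1))) ≤ 0 := by
    rintro t ⟨ht0, ht1⟩
    have hmem : (1 - t) • p₁ + t • p ∈ P :=
      hPconv hp₁ hp (by linarith) ht0.le (by ring)
    have h := sub_nonneg.2 (hmin _ hmem)
    unfold KL2 at h
    rw [← Finset.sum_sub_distrib] at h
    have hle : ∑ x, q₁ x * ((p x / p₁ x - 1) / (1 + t * (p x / p₁ x - 1))) * (t / Real.log 2)
        ≤ ∑ x, -(q₁ x * Real.logb 2 (q₁ x / ((1 - t) • p₁ + t • p) x)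
          - q₁ x * Real.logb 2 (q₁ x / p₁ x)) := by
      refine Finset.sum_le_sum fun x _ => ?_
      by_cases hx : q₁ x = 0
      · simp [hx]
      have h1 := pos _ hp₁ x hx
      have h2 := pos _ hp x hx
      have h3 := pos _ hmem x hx
      have hr : ((1 - t) • p₁ + t • p) x = p₁ x * (1 + t * (p x / p₁ x - 1)) := by
        simp only [Pi.add_apply, Pi.smul_apply, smul_eq_mul]
        field_simp
        ring
      have h4 : 0 < 1 + t * (p x / p₁ x - 1) := by
        rw [hr] at h3
        exact pos_of_mul_pos_right h3 h1.le
      have hlog := Real.one_sub_inv_le_log_of_pos h4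
      have heq : 1 - (1 + t * (p x / p₁ x - 1))⁻¹
          = (p x / p₁ x - 1) / (1 + t * (p x / p₁ x - 1)) * t := by
        generalize p x / p₁ x - 1 = u at h4 ⊢
        field_simp
        ring
      rw [hr, Real.logb_div hx (by positivity), Real.logb_div hx h1.ne',
        Real.logb_mul h1.ne' h4.ne']
      rw [heq] at hlog
      have hl2 : 0 < Real.log 2 := Real.log_pos (by norm_num)
      calc _ = q₁ x * (((p x / p₁ x - 1) / (1 + t * (p x / p₁ x - 1)) * t) / Real.log 2) := by
            ring
        _ ≤ q₁ x * (Real.log (1 + t * (p x / p₁ x - 1)) / Real.log 2) := by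
            have := hq.1 x
            gcongr
        _ = _ := by
            rw [Real.log_div_log]
            ring
    rw [Finset.sum_neg_distrib, ← Finset.sum_mul] at hle
    have hc : 0 < t / Real.log 2 := div_pos ht0 (Real.log_pos (by norm_num))
    exact nonpos_of_mul_nonpos_left (by linarith) hc
  have hlim : Filter.Tendsto
      (fun t : ℝ => ∑ x, q₁ x * ((p x / p₁ x - 1) / (1 + t * (p x / p₁ x - 1))))
      (nhdsWithin 0 (Set.Ioi 0)) (nhds (∑ x, q₁ x * (p x / p₁ x - 1))) := by
    refine tendsto_finsetSum _ fun x _ => ?_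
    have : ContinuousAt
        (fun t : ℝ => q₁ x * ((p x / p₁ x - 1) / (1 + t * (p x / p₁ x - 1)))) 0 := by
      fun_prop (disch := simp)
    simpa [ContinuousAt] using this.tendsto.mono_left (nhdsWithin_le_nhds (s := Set.Ioi 0))
  have hfin : ∑ x, q₁ x * (p x / p₁ x - 1) ≤ 0 :=
    le_of_tendsto hlim (Filter.mem_of_superset (Ioo_mem_nhdsGT one_pos) key)
  have : ∑ x, p x * (2 : ℝ) ^ Real.logb 2 (q₁ x / p₁ x)
      = ∑ x, q₁ x * (p x / p₁ x - 1) + ∑ x, q₁ x := by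
    rw [← Finset.sum_add_distrib]
    refine Finset.sum_congr rfl fun x _ => ?_
    by_cases hx : q₁ x = 0
    · simp [hx, (hac p hp x).2 hx]
    have h1 := pos _ hp₁ x hx
    have h2 : 0 < q₁ x := lt_of_le_of_ne (hq.1 x) (Ne.symm hx)
    rw [Real.rpow_logb (by norm_num) (by norm_num) (by positivity)]
    ring
  rw [this, hq.2]
  linarith

theorem seqProb_cons [Fintype 𝒳] (str : List 𝒳 → 𝒳 → ℝ) (a : 𝒳) (l : List 𝒳) :
    seqProb str (a :: l) = str [] a * seqProb (fun m => str (a :: m)) l := by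
  simp [seqProb, Fin.prod_univ_succ]

theorem llSum2_cons (p q : 𝒳 → ℝ) (a : 𝒳) (l : List 𝒳) :
    llSum2 p q (a :: l) = Real.logb 2 (p a / q a) + llSum2 p q l := by
  simp [llSum2, Fin.sum_univ_succ]

/-- Kraft-type inequality: the nonnegative supermartingale `2 ^ S_t` has total expectation at most
one over any finite prefix-free family of sequences. -/
theorem sum_seqProb_mul_le_one [Fintype 𝒳] {P : Set (𝒳 → ℝ)} {p q : 𝒳 → ℝ}
    (hP : ∀ p ∈ P, IsDist p)
    (hw : ∀ r ∈ P, ∑ x, r x * (2 : ℝ) ^ Real.logb 2 (q x / p x) ≤ 1)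
    (n : ℕ) (str : List 𝒳 → 𝒳 → ℝ) (hstr : IsStrategy P str) (s : Finset (List 𝒳))
    (hlen : ∀ l ∈ s, l.length < n) (hs : ∀ l ∈ s, ∀ m ∈ s, l <+: m → l = m) :
    ∑ l ∈ s, seqProb str l * (2 : ℝ) ^ llSum2 q p l ≤ 1 := by
  classical
  induction n generalizing str s with
  | zero =>
    have : s = ∅ := Finset.eq_empty_of_forall_notMem fun l hl => Nat.not_lt_zero _ (hlen l hl)
    simp [this]
  | succ n ih =>
    by_cases hnil : [] ∈ s
    · have : s = {[]} := Finset.eq_singleton_iff_unique_mem.2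
        ⟨hnil, fun l hl => (hs _ hnil l hl List.nil_prefix).symm⟩
      simp [this, seqProb, llSum2]
    let tails (a : 𝒳) : Finset (List 𝒳) := s.preimage (List.cons a) (by simp [Set.InjOn])
    have hunion : s = Finset.univ.biUnion fun a => (tails a).image (List.cons a) := by
      ext l
      cases l with
      | nil => simp [hnil]
      | cons a l => simpa using Finset.mem_preimage.symm
    have hdisj : Set.PairwiseDisjoint (↑(Finset.univ : Finset 𝒳))
        fun a => (tails a).image (List.cons a) := by
      intro a _ b _ hab
      simp only [Function.onFun, Finset.disjoint_left, Finset.mem_image]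
      rintro _ ⟨l, _, rfl⟩ ⟨m, _, h⟩
      exact hab (List.cons.inj h).1.symm
    rw [hunion, Finset.sum_biUnion hdisj]
    refine le_trans (Finset.sum_le_sum fun a _ => ?_) (hw _ (hstr []))
    rw [Finset.sum_image (by simp [Set.InjOn])]
    have htail : ∑ l ∈ tails a, seqProb (fun m => str (a :: m)) l * (2 : ℝ) ^ llSum2 q p l
        ≤ 1 :=
      ih _ (fun l => hstr _) _
        (fun l hl => by simpa using hlen _ (Finset.mem_preimage.1 hl))
        fun l hl m hm h => (List.cons.inj (hs _ (Finset.mem_preimage.1 hl) _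
          (Finset.mem_preimage.1 hm) (List.cons_prefix_cons.2 ⟨rfl, h⟩))).2
    calc _ = str [] a * (2 : ℝ) ^ Real.logb 2 (q a / p a) *
          ∑ l ∈ tails a, seqProb (fun m => str (a :: m)) l * (2 : ℝ) ^ llSum2 q p l := by
          rw [Finset.mul_sum]
          refine Finset.sum_congr rfl fun l _ => ?_
          rw [seqProb_cons, llSum2_cons, Real.rpow_add (by norm_num)]
          ring
      _ ≤ _ := mul_le_of_le_one_right
          (mul_nonneg ((hP _ (hstr [])).1 a) (by positivity)) htail

theorem stopsAt.eq_of_prefix {B : List 𝒳 → Prop} {l m : List 𝒳} (hl : stopsAt B l)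
    (hm : stopsAt B m) (h : l <+: m) : l = m := by
  by_contra hne
  have hlt : l.length < m.length :=
    lt_of_le_of_ne h.length_le fun he => hne (h.eq_of_length he)
  exact hm.2 _ hlt (List.prefix_iff_eq_take.1 h ▸ hl.1)

/-- For `θ₁ > 0` and `τ₁ = inf{t : S_{1,t} ≥ θ₁}` (base-2 logarithms),
under any adaptive adversary strategy for `H₀` (law `ℙ`), `E_ℙ[2^{S_{1,τ₁}}] ≤ 1`. -/
theorem stmt8 [Fintype 𝒳] [Nonempty 𝒳]
    (P Q : Set (𝒳 → ℝ))
    (hP : ∀ p ∈ P, IsDist p) (hQ : ∀ q ∈ Q, IsDist q)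
    (hPclosed : IsClosed P) (hQclosed : IsClosed Q)
    (hPconv : Convex ℝ P) (hQconv : Convex ℝ Q)
    (hdisj : Disjoint P Q)
    (hac : ∀ p ∈ P, ∀ q ∈ Q, ∀ x, (p x = 0 ↔ q x = 0))
    (p₁ q₁ : 𝒳 → ℝ) (hp₁ : p₁ ∈ P) (hq₁ : q₁ ∈ Q)
    (hmin₁ : ∀ p ∈ P, ∀ q ∈ Q, KL2 q₁ p₁ ≤ KL2 q p)
    (strP : List 𝒳 → 𝒳 → ℝ) (hstrP : IsStrategy P strP)
    (θ₁ : ℝ) (hθ₁ : 0 < θ₁) :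
    expStopped strP (fun l => θ₁ ≤ llSum2 q₁ p₁ l)
      (fun l => (2 : ℝ) ^ llSum2 q₁ p₁ l) ≤ 1 := by
  classical
  have hw : ∀ r ∈ P, ∑ x, r x * (2 : ℝ) ^ Real.logb 2 (q₁ x / p₁ x) ≤ 1 := fun r hr =>
    sum_mul_rpow_logb_le_one hP hPconv (hQ _ hq₁) (fun p hp => hac p hp q₁ hq₁) hp₁ hr
      fun p hp => hmin₁ p hp q₁ hq₁
  unfold expStopped
  refine tsum_le_of_sum_le' zero_le_one fun s => ?_
  rw [← Finset.sum_filter]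
  refine sum_seqProb_mul_le_one hP hw (s.sup List.length + 1) strP hstrP _
    (fun l hl => Nat.lt_succ_of_le (Finset.le_sup (Finset.mem_filter.1 hl).1)) fun l hl m hm h => ?_
  exact (Finset.mem_filter.1 hl).2.eq_of_prefix (Finset.mem_filter.1 hm).2 h
end
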